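/- arXiv:2303.00220 — 3 statements merged into one kernel-verified Lean document; each statement's English description precedes it below -/
import Mathlib

section
/- Let r ≥ 0 be a finite integer and let F : [0,1]² → ℝ be of class C^r. Then for every multi-index k = (k₁,k₂) with k₁ + k₂ ≤ r, the partial derivatives ∂^{k₁+k₂}B_{m,n}^F/∂x^{k₁}∂y^{k₂} of the two-variable Bernstein polynomials converge to ∂^{k₁+k₂}F/∂x^{k₁}∂y^{k₂} uniformly on [0,1]² as (m,n) → ∞ (i.e., as min(m,n) → ∞). -/
open Filter

/-- Partial derivative in the first variable. -/
noncomputable def pd1 (f : ℝ → ℝ → ℝ) : ℝ → ℝ → ℝ :=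
  fun x y => deriv (fun x' => f x' y) x

/-- Partial derivative in the second variable. -/
noncomputable def pd2 (f : ℝ → ℝ → ℝ) : ℝ → ℝ → ℝ :=
  fun x y => deriv (fun y' => f x y') y

/-- Mixed partial derivative `∂^{k₁+k₂} f / ∂x^{k₁} ∂y^{k₂}`. -/
noncomputable def pdMix (k₁ k₂ : ℕ) (f : ℝ → ℝ → ℝ) : ℝ → ℝ → ℝ :=
  pd1^[k₁] (pd2^[k₂] f)

/-- The two-variable Bernstein polynomial of `F` of bidegree `(m, n)`:
`B_{m,n}^F(x,y) = Σ_{r=0}^{m} Σ_{s=0}^{n} F(r/m, s/n) C(m,r) C(n,s)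
  x^r y^s (1−x)^{m−r} (1−y)^{n−s}`. -/
noncomputable def bernstein2 (F : ℝ → ℝ → ℝ) (m n : ℕ) : ℝ → ℝ → ℝ :=
  fun x y =>
    ∑ r ∈ Finset.range (m + 1), ∑ s ∈ Finset.range (n + 1),
      F ((r : ℝ) / m) ((s : ℝ) / n) * (m.choose r) * (n.choose s) *
        x ^ r * y ^ s * (1 - x) ^ (m - r) * (1 - y) ^ (n - s)

/-- The polynomial of degree at most `n` with Bernstein coefficients `c 0, …, c n`. -/
noncomputable def bernsteinSum (n : ℕ) (c : ℕ → ℝ) (x : ℝ) : ℝ :=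
  ∑ i ∈ Finset.range (n + 1), c i * (bernsteinPolynomial ℝ n i).eval x

theorem contDiff_bernsteinSum (n : ℕ) (c : ℕ → ℝ) {k : WithTop ℕ∞} :
    ContDiff ℝ k (bernsteinSum n c) := by
  unfold bernsteinSum
  simpa using ContDiff.sum fun i _ =>
    contDiff_const.mul ((bernsteinPolynomial ℝ n i).contDiff_aeval k)

theorem deriv_bernsteinSum_succ (n : ℕ) (c : ℕ → ℝ) :
    deriv (bernsteinSum (n + 1) c) =
      bernsteinSum n (fun i => (n + 1) * (c (i + 1) - c i)) := by
  ext x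
  have hderiv : HasDerivAt (bernsteinSum (n + 1) c) (∑ i ∈ Finset.range (n + 1 + 1),
      c i * (bernsteinPolynomial ℝ (n + 1) i).derivative.eval x) x := by
    unfold bernsteinSum
    exact HasDerivAt.fun_sum fun i _ => (Polynomial.hasDerivAt _ x).const_mul (c i)
  have hshift : ∑ i ∈ Finset.range (n + 1), c (i + 1) * (bernsteinPolynomial ℝ n (i + 1)).eval x +
      c 0 * (bernsteinPolynomial ℝ n 0).eval x =
      ∑ i ∈ Finset.range (n + 1), c i * (bernsteinPolynomial ℝ n i).eval x := by
    rw [← Finset.sum_range_succ' fun i => c i * (bernsteinPolynomial ℝ n i).eval x,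
      Finset.sum_range_succ, bernsteinPolynomial.eq_zero_of_lt ℝ (Nat.lt_succ_self n)]
    simp
  rw [hderiv.deriv, Finset.sum_range_succ', bernsteinPolynomial.derivative_zero]
  simp only [bernsteinPolynomial.derivative_succ, bernsteinSum, Nat.add_sub_cancel,
    Polynomial.eval_mul, Polynomial.eval_sub, Polynomial.eval_natCast, Polynomial.eval_neg]
  simp only [mul_sub, sub_mul, Finset.sum_sub_distrib, mul_assoc, ← Finset.mul_sum]
  simp only [mul_left_comm (c _), ← Finset.mul_sum, Nat.cast_succ, ← hshift]
  ring

theorem iterate_deriv_bernsteinSum (k n : ℕ) (h : ℝ) (φ : ℝ → ℝ) :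
    deriv^[k] (bernsteinSum (n + k) fun i => φ (i * h)) =
      bernsteinSum n fun i => (n + k).descFactorial k * (fwdDiff h)^[k] φ (i * h) := by
  induction k generalizing φ with
  | zero => simp
  | succ k ih =>
    have hsmul : (fun i : ℕ => ((n + k : ℕ) + 1 : ℝ) * (φ ((i + 1 : ℕ) * h) - φ (i * h))) =
        fun i : ℕ => (((n + k : ℕ) + 1 : ℝ) • fwdDiff h φ) (i * h) := by
      ext i
      simp [fwdDiff, add_mul]
    rw [Function.iterate_succ_apply, ← add_assoc, deriv_bernsteinSum_succ, hsmul, ih,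
      fwdDiff_iter_const_smul]
    congr 1
    ext i
    rw [Nat.succ_descFactorial_succ, Function.iterate_succ_apply]
    simp
    ring

theorem iterate_pd1_apply (k : ℕ) (f : ℝ → ℝ → ℝ) (x y : ℝ) :
    pd1^[k] f x y = deriv^[k] (fun x' => f x' y) x := by
  induction k generalizing f with
  | zero => rfl
  | succ k ih => rw [Function.iterate_succ_apply, ih]; rfl

theorem iterate_pd2_apply (k : ℕ) (f : ℝ → ℝ → ℝ) (x y : ℝ) :
    pd2^[k] f x y = deriv^[k] (f x) y := by
  induction k generalizing f with
  | zero => rfl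
  | succ k ih => rw [Function.iterate_succ_apply, ih]; rfl

theorem fwdDiff_iter_map {M G H : Type*} [AddCommMonoid M] [AddCommGroup G] [AddCommGroup H]
    (L : G →+ H) (h : M) (f : M → G) (k : ℕ) (u : M) :
    (fwdDiff h)^[k] (fun v => L (f v)) u = L ((fwdDiff h)^[k] f u) := by
  induction k generalizing u with
  | zero => rfl
  | succ k ih => simp only [Function.iterate_succ_apply', fwdDiff, ih, map_sub]

theorem bernsteinSum_add (n : ℕ) (c d : ℕ → ℝ) (x : ℝ) :
    bernsteinSum n (fun i => c i + d i) x = bernsteinSum n c x + bernsteinSum n d x := by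
  simp only [bernsteinSum, add_mul, Finset.sum_add_distrib]

theorem bernsteinSum_sub (n : ℕ) (c d : ℕ → ℝ) (x : ℝ) :
    bernsteinSum n (fun i => c i - d i) x = bernsteinSum n c x - bernsteinSum n d x := by
  simp only [bernsteinSum, sub_mul, Finset.sum_sub_distrib]

theorem bernsteinSum_congr {n : ℕ} {c d : ℕ → ℝ} (h : ∀ i ≤ n, c i = d i) (x : ℝ) :
    bernsteinSum n c x = bernsteinSum n d x :=
  Finset.sum_congr rfl fun i hi => by rw [h i (Finset.mem_range_succ_iff.1 hi)]

theorem abs_bernsteinSum_le {n : ℕ} {c : ℕ → ℝ} {ε : ℝ} (h : ∀ i ≤ n, |c i| ≤ ε) {x : ℝ}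
    (hx : x ∈ Set.Icc (0 : ℝ) 1) : |bernsteinSum n c x| ≤ ε := by
  have hnonneg (i : ℕ) : 0 ≤ (bernsteinPolynomial ℝ n i).eval x := by
    have := sub_nonneg.2 hx.2
    have := hx.1
    simp only [bernsteinPolynomial, Polynomial.eval_mul, Polynomial.eval_pow, Polynomial.eval_sub,
      Polynomial.eval_natCast, Polynomial.eval_X, Polynomial.eval_one]
    positivity
  calc |bernsteinSum n c x|
      ≤ ∑ i ∈ Finset.range (n + 1), |c i * (bernsteinPolynomial ℝ n i).eval x| :=
        Finset.abs_sum_le_sum_abs _ _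
    _ ≤ ∑ i ∈ Finset.range (n + 1), ε * (bernsteinPolynomial ℝ n i).eval x := by
        refine Finset.sum_le_sum fun i hi => ?_
        rw [abs_mul, abs_of_nonneg (hnonneg i)]
        exact mul_le_mul_of_nonneg_right (h i (Finset.mem_range_succ_iff.1 hi)) (hnonneg i)
    _ = ε := by
        rw [← Finset.mul_sum, ← Polynomial.eval_finsetSum, bernsteinPolynomial.sum]
        simp

theorem pdMix_bernsteinSum (k₁ k₂ m n : ℕ) (h₁ h₂ : ℝ) (F : ℝ → ℝ → ℝ) (x y : ℝ) :
    pdMix k₁ k₂ (fun x y => bernsteinSum (m + k₁)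
        (fun i => bernsteinSum (n + k₂) (fun j => F (i * h₁) (j * h₂)) y) x) x y =
      bernsteinSum m (fun i => (m + k₁).descFactorial k₁ *
        bernsteinSum n (fun j => (n + k₂).descFactorial k₂ *
          (fwdDiff h₂)^[k₂] ((fwdDiff h₁)^[k₁] F (i * h₁)) (j * h₂)) y) x := by
  have hinner (x' : ℝ) : pd2^[k₂] (fun x y => bernsteinSum (m + k₁)
        (fun i => bernsteinSum (n + k₂) (fun j => F (i * h₁) (j * h₂)) y) x) x' y =
      bernsteinSum (m + k₁) (fun i => bernsteinSum n (fun j => (n + k₂).descFactorial k₂ *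
          (fwdDiff h₂)^[k₂] (F (i * h₁)) (j * h₂)) y) x' := by
    rw [iterate_pd2_apply, ← iteratedDeriv_eq_iterate]
    simp only [bernsteinSum.eq_1 (m + k₁)]
    rw [iteratedDeriv_fun_sum fun i _ =>
      ((contDiff_bernsteinSum _ _).mul contDiff_const).contDiffAt]
    refine Finset.sum_congr rfl fun i _ => ?_
    simp only [mul_comm _ (Polynomial.eval _ _)]
    rw [iteratedDeriv_const_mul_field, iteratedDeriv_eq_iterate, iterate_deriv_bernsteinSum]
  let L : (ℝ → ℝ) →+ ℝ := AddMonoidHom.mk' (fun f => bernsteinSum n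
    (fun j => (n + k₂).descFactorial k₂ * (fwdDiff h₂)^[k₂] f (j * h₂)) y) fun f g => by
      rw [← bernsteinSum_add]
      simp only [fwdDiff_iter_add, Pi.add_apply, mul_add]
  rw [pdMix, iterate_pd1_apply]
  simp only [hinner]
  rw [show (fun x' => bernsteinSum (m + k₁) (fun i => bernsteinSum n
    (fun j => (n + k₂).descFactorial k₂ * (fwdDiff h₂)^[k₂] (F (i * h₁)) (j * h₂)) y) x') =
    bernsteinSum (m + k₁) (fun i => (fun u => L (F u)) (i * h₁)) from rfl,
    iterate_deriv_bernsteinSum k₁ m h₁ fun u => L (F u)]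
  simp only [fwdDiff_iter_map]
  rfl

theorem differentiable_fwdDiff_iter {g : ℝ → ℝ} (hg : Differentiable ℝ g) (h : ℝ) (k : ℕ) :
    Differentiable ℝ ((fwdDiff h)^[k] g) := by
  induction k with
  | zero => exact hg
  | succ k ih =>
    rw [Function.iterate_succ_apply']
    exact (ih.comp (differentiable_id.add_const h)).sub ih

theorem deriv_fwdDiff_iter {g : ℝ → ℝ} (hg : Differentiable ℝ g) (h : ℝ) (k : ℕ) :
    deriv ((fwdDiff h)^[k] g) = (fwdDiff h)^[k] (deriv g) := by
  induction k with
  | zero => rfl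
  | succ k ih =>
    have hk := differentiable_fwdDiff_iter hg h k
    rw [Function.iterate_succ_apply', Function.iterate_succ_apply', ← ih]
    ext x
    have hshift : DifferentiableAt ℝ (fun y => (fwdDiff h)^[k] g (y + h)) x :=
      (hk.comp (differentiable_id.add_const h)) x
    exact (deriv_fun_sub hshift (hk x)).trans (by rw [deriv_comp_add_const]; rfl)

/-- The iterated mean value theorem for forward differences. -/
theorem exists_fwdDiff_iter_eq {k : ℕ} {g : ℝ → ℝ} (hg : ContDiff ℝ k g) {h : ℝ} (hh : 0 < h)
    (x : ℝ) : ∃ ξ ∈ Set.Icc x (x + k * h), (fwdDiff h)^[k] g x = h ^ k * deriv^[k] g ξ := by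
  induction k generalizing g x with
  | zero => exact ⟨x, by simp⟩
  | succ k ih =>
    have hg' : ContDiff ℝ (k + 1) g := by exact_mod_cast hg
    have hdiff : Differentiable ℝ g := hg'.differentiable (by simp)
    have hk := differentiable_fwdDiff_iter hdiff h k
    obtain ⟨c, hc, hslope⟩ := exists_deriv_eq_slope ((fwdDiff h)^[k] g) (lt_add_of_pos_right x hh)
      hk.continuous.continuousOn hk.differentiableOn
    obtain ⟨ξ, hξ, heq⟩ := ih (contDiff_succ_iff_deriv.1 hg').2.2 c
    refine ⟨ξ, ⟨hc.1.le.trans hξ.1, ?_⟩, ?_⟩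
    · have := hξ.2
      have := hc.2
      push_cast
      linarith
    · rw [deriv_fwdDiff_iter hdiff, heq, add_sub_cancel_left, eq_div_iff hh.ne'] at hslope
      rw [Function.iterate_succ_apply', Function.iterate_succ_apply, fwdDiff, ← hslope]
      ring

theorem ContDiff.uncurry_pd1 {n : WithTop ℕ∞} {f : ℝ → ℝ → ℝ}
    (hf : ContDiff ℝ (n + 1) (Function.uncurry f)) : ContDiff ℝ n (Function.uncurry (pd1 f)) := by
  have heq : Function.uncurry (pd1 f) = fun p => fderiv ℝ (Function.uncurry f) p (1, 0) := by
    ext ⟨x, y⟩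
    have hd := (hf.differentiable (by simp) (x, y)).hasFDerivAt
    exact (hd.comp_hasDerivAt x ((hasDerivAt_id x).prodMk (hasDerivAt_const x y))).deriv
  rw [heq]
  exact (hf.fderiv_right le_rfl).clm_apply contDiff_const

theorem ContDiff.uncurry_pd2 {n : WithTop ℕ∞} {f : ℝ → ℝ → ℝ}
    (hf : ContDiff ℝ (n + 1) (Function.uncurry f)) : ContDiff ℝ n (Function.uncurry (pd2 f)) := by
  have heq : Function.uncurry (pd2 f) = fun p => fderiv ℝ (Function.uncurry f) p (0, 1) := by
    ext ⟨x, y⟩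
    have hd := (hf.differentiable (by simp) (x, y)).hasFDerivAt
    exact (hd.comp_hasDerivAt y ((hasDerivAt_const y x).prodMk (hasDerivAt_id y))).deriv
  rw [heq]
  exact (hf.fderiv_right le_rfl).clm_apply contDiff_const

theorem ContDiff.uncurry_iterate_pd1 {k : ℕ} {n : WithTop ℕ∞} {f : ℝ → ℝ → ℝ}
    (hf : ContDiff ℝ (n + k) (Function.uncurry f)) :
    ContDiff ℝ n (Function.uncurry (pd1^[k] f)) := by
  induction k generalizing f with
  | zero => simpa using hf
  | succ k ih => exact ih (ContDiff.uncurry_pd1 (by simpa [add_assoc] using hf))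

theorem ContDiff.uncurry_iterate_pd2 {k : ℕ} {n : WithTop ℕ∞} {f : ℝ → ℝ → ℝ}
    (hf : ContDiff ℝ (n + k) (Function.uncurry f)) :
    ContDiff ℝ n (Function.uncurry (pd2^[k] f)) := by
  induction k generalizing f with
  | zero => simpa using hf
  | succ k ih => exact ih (ContDiff.uncurry_pd2 (by simpa [add_assoc] using hf))

theorem contDiff_and_iterate_deriv_fwdDiff_iter {k : ℕ} {F : ℝ → ℝ → ℝ} (hF : ∀ u, ContDiff ℝ k (F u))
    (h : ℝ) (l : ℕ) (u v : ℝ) :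
    ContDiff ℝ k ((fwdDiff h)^[l] F u) ∧
      deriv^[k] ((fwdDiff h)^[l] F u) v = (fwdDiff h)^[l] (fun x => deriv^[k] (F x) v) u := by
  induction l generalizing u with
  | zero => exact ⟨hF u, rfl⟩
  | succ l ih =>
    simp only [Function.iterate_succ_apply', fwdDiff]
    refine ⟨(ih (u + h)).1.sub (ih u).1, ?_⟩
    rw [← (ih u).2, ← (ih (u + h)).2]
    simp only [← iteratedDeriv_eq_iterate]
    exact iteratedDeriv_sub (ih (u + h)).1.contDiffAt (ih u).1.contDiffAt

theorem exists_fwdDiff_iter_fwdDiff_iter_eq {k₁ k₂ : ℕ} {F : ℝ → ℝ → ℝ}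
    (hF : ContDiff ℝ (k₁ + k₂ : ℕ) (Function.uncurry F)) {h₁ h₂ : ℝ} (hh₁ : 0 < h₁) (hh₂ : 0 < h₂)
    (x y : ℝ) : ∃ ξ ∈ Set.Icc x (x + k₁ * h₁), ∃ η ∈ Set.Icc y (y + k₂ * h₂),
      (fwdDiff h₂)^[k₂] ((fwdDiff h₁)^[k₁] F x) y = h₁ ^ k₁ * h₂ ^ k₂ * pdMix k₁ k₂ F ξ η := by
  have hF₂ (u : ℝ) : ContDiff ℝ k₂ (F u) :=
    (hF.of_le (by exact_mod_cast Nat.le_add_left _ _)).comp (contDiff_const.prodMk contDiff_id)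
  obtain ⟨η, hη, heq₂⟩ := exists_fwdDiff_iter_eq
    (contDiff_and_iterate_deriv_fwdDiff_iter hF₂ h₁ k₁ x 0).1 hh₂ y
  have hF₁ : ContDiff ℝ k₁ (fun x => pd2^[k₂] F x η) :=
    (ContDiff.uncurry_iterate_pd2 (by exact_mod_cast hF)).comp (contDiff_id.prodMk contDiff_const)
  obtain ⟨ξ, hξ, heq₁⟩ := exists_fwdDiff_iter_eq hF₁ hh₁ x
  refine ⟨ξ, hξ, η, hη, ?_⟩
  simp only [iterate_pd2_apply] at heq₁
  rw [heq₂, (contDiff_and_iterate_deriv_fwdDiff_iter hF₂ h₁ k₁ x η).2, heq₁, pdMix, iterate_pd1_apply]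
  simp only [iterate_pd2_apply]
  ring

theorem continuous_uncurry_pdMix {k₁ k₂ : ℕ} {F : ℝ → ℝ → ℝ}
    (hF : ContDiff ℝ (k₁ + k₂ : ℕ) (Function.uncurry F)) :
    Continuous (Function.uncurry (pdMix k₁ k₂ F)) := by
  have h₂ : ContDiff ℝ k₁ (Function.uncurry (pd2^[k₂] F)) :=
    ContDiff.uncurry_iterate_pd2 (by exact_mod_cast hF)
  exact (ContDiff.uncurry_iterate_pd1 (n := 0) (by simpa using h₂)).continuous

theorem eventually_bernsteinSum_sub_lt {G : ℝ → ℝ → ℝ} (hG : Continuous (Function.uncurry G))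
    {ε : ℝ} (hε : 0 < ε) : ∀ᶠ n : ℕ in atTop, ∀ x ∈ Set.Icc (0 : ℝ) 1, ∀ y ∈ Set.Icc (0 : ℝ) 1,
      |bernsteinSum n (fun i => G (i / n) y) x - G x y| < ε := by
  let g : C(unitInterval, C(unitInterval, ℝ)) :=
    ContinuousMap.curry ⟨fun p => G p.1 p.2,
      hG.comp (continuous_subtype_val.prodMap continuous_subtype_val)⟩
  filter_upwards [(bernsteinApproximation_uniform g).eventually_mem (Metric.ball_mem_nhds g hε)]
    with n hn x hx y hy
  have hlt := (ContinuousMap.dist_lt_iff hε).1 ((ContinuousMap.dist_lt_iff hε).1 hn ⟨x, hx⟩) ⟨y, hy⟩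
  rw [Real.dist_eq, bernsteinApproximation.apply] at hlt
  convert hlt using 3
  · simp only [bernsteinSum, Finset.sum_range, bernstein, g, bernstein.z, ContinuousMap.coe_sum,
      Finset.sum_apply, ContinuousMap.coe_smul, Pi.smul_apply, smul_eq_mul]
    exact Finset.sum_congr rfl fun i _ => mul_comm _ _
  · rfl

theorem eventually_bernsteinSum_bernsteinSum_sub_lt {G : ℝ → ℝ → ℝ}
    (hG : Continuous (Function.uncurry G)) {ε : ℝ} (hε : 0 < ε) :
    ∀ᶠ mn : ℕ × ℕ in atTop, ∀ x ∈ Set.Icc (0 : ℝ) 1, ∀ y ∈ Set.Icc (0 : ℝ) 1,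
      |bernsteinSum mn.1 (fun i => bernsteinSum mn.2 (fun j => G (i / mn.1) (j / mn.2)) y) x -
        G x y| < ε := by
  have hswap : Continuous (Function.uncurry fun y x => G x y) := hG.comp continuous_swap
  rw [← prod_atTop_atTop_eq]
  filter_upwards [(eventually_bernsteinSum_sub_lt hG (half_pos hε)).prod_mk
    (eventually_bernsteinSum_sub_lt hswap (half_pos hε))] with ⟨m, n⟩ ⟨hm, hn⟩ x hx y hy
  have hinner : |bernsteinSum m (fun i =>
      bernsteinSum n (fun j => G (i / m) (j / n)) y - G (i / m) y) x| ≤ ε / 2 :=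
    abs_bernsteinSum_le (fun i hi => (hn y hy _ ⟨by positivity, div_le_one_of_le₀
      (by exact_mod_cast hi) (by positivity)⟩).le) hx
  rw [bernsteinSum_sub] at hinner
  have houter := hm x hx y hy
  rw [abs_le] at hinner
  rw [abs_lt] at houter ⊢
  constructor <;> linarith [hinner.1, hinner.2, houter.1, houter.2]

theorem bernstein2_eq_bernsteinSum (F : ℝ → ℝ → ℝ) (m n : ℕ) :
    bernstein2 F m n = fun x y =>
      bernsteinSum m (fun i => bernsteinSum n (fun j => F (i * (m : ℝ)⁻¹) (j * (n : ℝ)⁻¹)) y) x := by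
  ext x y
  simp only [bernstein2, bernsteinSum, bernsteinPolynomial, Finset.sum_mul, ← div_eq_mul_inv,
    Polynomial.eval_mul, Polynomial.eval_pow, Polynomial.eval_sub, Polynomial.eval_natCast,
    Polynomial.eval_X, Polynomial.eval_one]
  refine Finset.sum_congr rfl fun i _ => Finset.sum_congr rfl fun j _ => ?_
  ring

theorem const_mul_bernsteinSum (n : ℕ) (a : ℝ) (c : ℕ → ℝ) (x : ℝ) :
    a * bernsteinSum n c x = bernsteinSum n (fun i => a * c i) x := by
  simp only [bernsteinSum, Finset.mul_sum, mul_assoc]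

theorem exists_pdMix_bernstein2_eq {k₁ k₂ : ℕ} {F : ℝ → ℝ → ℝ}
    (hF : ContDiff ℝ (k₁ + k₂ : ℕ) (Function.uncurry F)) {m n : ℕ} (hm : k₁ < m) (hn : k₂ < n) :
    ∃ ξ η : ℕ → ℕ → ℝ,
      (∀ i j : ℕ, ξ i j ∈ Set.Icc (i / m : ℝ) ((i + k₁) / m)) ∧
      (∀ i j : ℕ, η i j ∈ Set.Icc (j / n : ℝ) ((j + k₂) / n)) ∧
      ∀ x y, pdMix k₁ k₂ (bernstein2 F m n) x y =
        bernsteinSum (m - k₁) (fun i => bernsteinSum (n - k₂) (fun j =>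
          (m.descFactorial k₁ / (m : ℝ) ^ k₁) * (n.descFactorial k₂ / (n : ℝ) ^ k₂) *
            pdMix k₁ k₂ F (ξ i j) (η i j)) y) x := by
  have hm₀ : (0 : ℝ) < (m : ℝ)⁻¹ := inv_pos.2 (by exact_mod_cast (Nat.zero_le k₁).trans_lt hm)
  have hn₀ : (0 : ℝ) < (n : ℝ)⁻¹ := inv_pos.2 (by exact_mod_cast (Nat.zero_le k₂).trans_lt hn)
  choose ξ hξ η hη heq using fun i j : ℕ =>
    exists_fwdDiff_iter_fwdDiff_iter_eq hF hm₀ hn₀ (i * (m : ℝ)⁻¹) (j * (n : ℝ)⁻¹)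
  refine ⟨ξ, η, fun i j => ?_, fun i j => ?_, fun x y => ?_⟩
  · simpa only [div_eq_mul_inv, add_mul] using hξ i j
  · simpa only [div_eq_mul_inv, add_mul] using hη i j
  · have hmix := pdMix_bernsteinSum k₁ k₂ (m - k₁) (n - k₂) (m : ℝ)⁻¹ (n : ℝ)⁻¹ F x y
    rw [Nat.sub_add_cancel hm.le, Nat.sub_add_cancel hn.le] at hmix
    rw [bernstein2_eq_bernsteinSum, hmix]
    simp only [heq, const_mul_bernsteinSum]
    refine bernsteinSum_congr (fun i _ => bernsteinSum_congr (fun j _ => ?_) y) x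
    simp only [div_eq_mul_inv, ← inv_pow]
    ring

theorem tendsto_descFactorial_div_pow (k : ℕ) :
    Tendsto (fun n : ℕ => (n.descFactorial k / (n : ℝ) ^ k : ℝ)) atTop (nhds 1) := by
  refine (Asymptotics.isEquivalent_iff_tendsto_one ?_).1 (isEquivalent_descFactorial k)
  filter_upwards [eventually_gt_atTop 0] with n hn
  positivity

theorem Icc_div_subset_unitInterval {i k m : ℕ} (hk : k < m) (hi : i ≤ m - k) :
    Set.Icc (i / m : ℝ) ((i + k) / m) ⊆ Set.Icc 0 1 :=
  Set.Icc_subset_Icc (by positivity)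
    (div_le_one_of_le₀ (by exact_mod_cast (by omega : i + k ≤ m)) (by positivity))

theorem div_sub_mem_Icc {i k m : ℕ} (hk : k < m) (hi : i ≤ m - k) :
    (i / (m - k : ℕ) : ℝ) ∈ Set.Icc (i / m : ℝ) ((i + k) / m) := by
  obtain ⟨l, rfl⟩ := Nat.exists_eq_add_of_lt hk
  have hi' : (i : ℝ) ≤ l + 1 := by exact_mod_cast (by omega : i ≤ l + 1)
  have hsub : k + l + 1 - k = l + 1 := by omega
  rw [hsub]
  push_cast
  constructor
  · gcongr
    linarith [(Nat.cast_nonneg k : (0 : ℝ) ≤ k)]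
  · rw [div_le_div_iff₀ (by positivity) (by positivity)]
    nlinarith [mul_le_mul_of_nonneg_right hi' (Nat.cast_nonneg k : (0 : ℝ) ≤ k)]

theorem abs_sub_div_sub_lt {i k m : ℕ} (hk : k < m) (hi : i ≤ m - k) {ξ δ : ℝ}
    (hξ : ξ ∈ Set.Icc (i / m : ℝ) ((i + k) / m)) (hδ : (k / m : ℝ) < δ) :
    |ξ - i / (m - k : ℕ)| < δ := by
  refine (Real.dist_le_of_mem_Icc hξ (div_sub_mem_Icc hk hi)).trans_lt ?_
  rwa [add_div, add_sub_cancel_left]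

/-- Kingsley's theorem: if `F` is of class `C^r` on the unit square `[0,1]²`
(i.e. `F` is the restriction of a `C^r` function of the plane), then for every
multi-index `(k₁, k₂)` with `k₁ + k₂ ≤ r`, the partial derivatives
`∂^{k₁+k₂} B_{m,n}^F / ∂x^{k₁} ∂y^{k₂}` of the two-variable Bernstein polynomials
converge uniformly on `[0,1]²` to `∂^{k₁+k₂} F / ∂x^{k₁} ∂y^{k₂}` as
`(m,n) → ∞` (the product `atTop` filter, i.e. `min(m,n) → ∞`). -/
theorem bernstein2_deriv_tendstoUniformlyOn
    (r : ℕ) (F : ℝ → ℝ → ℝ) (hF : ContDiff ℝ r (Function.uncurry F))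
    (k₁ k₂ : ℕ) (hk : k₁ + k₂ ≤ r) :
    TendstoUniformlyOn
      (fun mn : ℕ × ℕ => fun p : ℝ × ℝ => pdMix k₁ k₂ (bernstein2 F mn.1 mn.2) p.1 p.2)
      (fun p : ℝ × ℝ => pdMix k₁ k₂ F p.1 p.2)
      atTop
      (Set.Icc 0 1 ×ˢ Set.Icc 0 1) := by
  replace hF : ContDiff ℝ (k₁ + k₂ : ℕ) (Function.uncurry F) := hF.of_le (by exact_mod_cast hk)
  rw [Metric.tendstoUniformlyOn_iff]
  intro ε hε
  have hcont := continuous_uncurry_pdMix hF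
  set G := pdMix k₁ k₂ F
  have hcompact : IsCompact (Set.Icc (0 : ℝ) 1 ×ˢ Set.Icc (0 : ℝ) 1) :=
    isCompact_Icc.prod isCompact_Icc
  obtain ⟨C, hC⟩ := hcompact.exists_bound_of_continuousOn hcont.continuousOn
  have hC₀ : 0 ≤ C := (norm_nonneg _).trans (hC (0, 0) (by simp))
  obtain ⟨δ, hδ, hunif⟩ := Metric.uniformContinuousOn_iff.1
    (hcompact.uniformContinuousOn_of_continuous hcont.continuousOn) (ε / 3) (by positivity)
  have hbern := eventually_bernsteinSum_bernsteinSum_sub_lt hcont (by positivity : 0 < ε / 3)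
  rw [← prod_atTop_atTop_eq] at hbern ⊢
  have hshift := ((tendsto_sub_atTop_nat k₁).prodMap (tendsto_sub_atTop_nat k₂)).eventually hbern
  have hweight := ((tendsto_descFactorial_div_pow k₁).comp tendsto_fst).mul
    ((tendsto_descFactorial_div_pow k₂).comp (tendsto_snd (f := (atTop : Filter ℕ))))
  rw [one_mul] at hweight
  have hnear (k : ℕ) : ∀ᶠ n : ℕ in atTop, k < n ∧ (k / n : ℝ) < δ :=
    (eventually_gt_atTop k).and
      ((tendsto_const_div_atTop_nhds_zero_nat (k : ℝ)).eventually_lt_const hδ)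
  filter_upwards [hshift, (hnear k₁).prod_mk (hnear k₂),
    Metric.tendsto_nhds.1 hweight (ε / (3 * (C + 1))) (by positivity)]
    with ⟨m, n⟩ hB ⟨⟨hm, hmδ⟩, ⟨hn, hnδ⟩⟩ hw ⟨x, y⟩ ⟨hx, hy⟩
  obtain ⟨ξ, η, hξ, hη, heq⟩ := exists_pdMix_bernstein2_eq hF hm hn
  simp only [Function.comp_apply, Real.dist_eq, Prod.map] at hw hB hm hn hmδ hnδ
  set w := (m.descFactorial k₁ / (m : ℝ) ^ k₁) * (n.descFactorial k₂ / (n : ℝ) ^ k₂)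
  have hcoeff (i : ℕ) (hi : i ≤ m - k₁) (j : ℕ) (hj : j ≤ n - k₂) :
      |w * G (ξ i j) (η i j) - G (i / (m - k₁ : ℕ)) (j / (n - k₂ : ℕ))| ≤ 2 * ε / 3 := by
    have hmemξ := Icc_div_subset_unitInterval hm hi
    have hmemη := Icc_div_subset_unitInterval hn hj
    have hbound : |G (ξ i j) (η i j)| ≤ C := hC (ξ i j, η i j) ⟨hmemξ (hξ i j), hmemη (hη i j)⟩
    have hclose : |G (ξ i j) (η i j) - G (i / (m - k₁ : ℕ)) (j / (n - k₂ : ℕ))| < ε / 3 :=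
      hunif (ξ i j, η i j) ⟨hmemξ (hξ i j), hmemη (hη i j)⟩ (_, _)
        ⟨hmemξ (div_sub_mem_Icc hm hi), hmemη (div_sub_mem_Icc hn hj)⟩
        (max_lt (abs_sub_div_sub_lt hm hi (hξ i j) hmδ) (abs_sub_div_sub_lt hn hj (hη i j) hnδ))
    have hscale : |(w - 1) * G (ξ i j) (η i j)| ≤ ε / 3 := by
      rw [abs_mul]
      calc |w - 1| * |G (ξ i j) (η i j)| ≤ ε / (3 * (C + 1)) * (C + 1) := by
            gcongr
            linarith
        _ = ε / 3 := by field_simp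
    calc _ = |(w - 1) * G (ξ i j) (η i j) +
          (G (ξ i j) (η i j) - G (i / (m - k₁ : ℕ)) (j / (n - k₂ : ℕ)))| := by ring_nf
      _ ≤ _ := abs_add_le _ _
      _ ≤ 2 * ε / 3 := by linarith
  have hsum := abs_bernsteinSum_le
    (fun i hi => abs_bernsteinSum_le (fun j hj => hcoeff i hi j hj) hy) hx
  simp only [bernsteinSum_sub] at hsum
  rw [← heq] at hsum
  have hlim := hB x hx y hy
  rw [Real.dist_eq, abs_sub_comm]
  rw [abs_le] at hsum
  rw [abs_lt] at hlim ⊢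
  constructor <;> linarith [hsum.1, hsum.2, hlim.1, hlim.2]
end

section
/- Let U ⊆ ℝⁿ be a connected open set and let f : U → ℝ be real-analytic on U and not identically zero. Then the zero set {x ∈ U : f(x) = 0} has Lebesgue measure zero. -/
open MeasureTheory Topology

/-- A real-analytic function on an open preconnected subset of `ℝ`, not identically zero, has a
zero set of measure zero. -/
theorem AnalyticOnNhd.volume_zero_set_of_isPreconnected {I : Set ℝ} (hI : IsOpen I)
    (hIconn : IsPreconnected I) {g : ℝ → ℝ} (hg : AnalyticOnNhd ℝ g I)
    {a : ℝ} (ha : a ∈ I) (hga : g a ≠ 0) : volume {t ∈ I | g t = 0} = 0 := by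
  have hmem := hg.preimage_zero_mem_codiscreteWithin hga ha ⟨⟨a, ha⟩, hIconn⟩
  have hae := ae_restrict_le_codiscreteWithin (μ := volume) hI.measurableSet hmem
  rw [mem_ae_iff, Measure.restrict_apply' hI.measurableSet] at hae
  convert hae using 2
  ext t
  simp [and_comm]

section

variable {E : Type*} [NormedAddCommGroup E] [NormedSpace ℝ E] [FiniteDimensional ℝ E]
  [MeasurableSpace E] [BorelSpace E] (μ : Measure E) [μ.IsAddHaarMeasure]

/-- A measurable set which meets every line through `c` in a null set is null. -/
theorem measure_eq_zero_of_forall_line {Z : Set E} (hZ : MeasurableSet Z) (c : E)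
    (h : ∀ y, volume {t : ℝ | c + t • y ∈ Z} = 0) : μ Z = 0 := by
  have : ProperSpace E := FiniteDimensional.proper_real E
  have hmeas : MeasurableSet {p : E × ℝ | c + p.2 • p.1 ∈ Z} :=
    hZ.preimage (f := fun p : E × ℝ => c + p.2 • p.1) (by fun_prop)
  have hprod : (μ.prod volume) {p : E × ℝ | c + p.2 • p.1 ∈ Z} = 0 :=
    (Measure.measure_prod_null hmeas).2 (.of_forall h)
  have hswap : ∀ᵐ t : ℝ, μ {y | c + t • y ∈ Z} = 0 := by
    have h' := Measure.ae_ae_of_ae_prod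
      (Measure.measurePreserving_swap (μ := volume) (ν := μ)
        |>.quasiMeasurePreserving.ae (p := fun p : E × ℝ => ¬ c + p.2 • p.1 ∈ Z)
          (by rw [ae_iff]; simpa using hprod))
    filter_upwards [h'] with t ht
    simpa [ae_iff] using ht
  obtain ⟨t, ht, ht0⟩ := (hswap.and (Measure.ae_ne volume (0 : ℝ))).exists
  have hpre : {y | c + t • y ∈ Z} = (t • ·) ⁻¹' ((c + ·) ⁻¹' Z) := rfl
  rw [hpre, Measure.addHaar_preimage_smul μ ht0, measure_preimage_add, mul_eq_zero] at ht
  refine ht.resolve_left ?_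
  simpa using pow_pos (abs_pos.2 ht0) _

/-- On a convex open set, the zero set of a nonzero real-analytic function is null. -/
theorem AnalyticOnNhd.measure_zero_set_of_convex {V : Set E} (hV : IsOpen V)
    (hVconv : Convex ℝ V) {f : E → ℝ} (hf : AnalyticOnNhd ℝ f V) {c : E} (hc : c ∈ V)
    (hfc : f c ≠ 0) : μ {x ∈ V | f x = 0} = 0 := by
  have hZ : MeasurableSet {x ∈ V | f x = 0} := by
    have hopen : IsOpen (V ∩ f ⁻¹' {0}ᶜ) :=
      hf.continuousOn.isOpen_inter_preimage hV isOpen_compl_singleton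
    convert hV.measurableSet.diff hopen.measurableSet using 1
    ext x
    simp +contextual
  refine measure_eq_zero_of_forall_line μ hZ c fun y => ?_
  set l : ℝ → E := fun t => c + t • y with hl
  have hlan : AnalyticOnNhd ℝ l (l ⁻¹' V) := fun t _ => by fun_prop
  have hconv : Convex ℝ (l ⁻¹' V) := by
    have hpre : l ⁻¹' V = AffineMap.lineMap c (c + y) ⁻¹' V := by
      ext t
      simp [hl, AffineMap.lineMap_apply, add_comm]
    rw [hpre]
    exact hVconv.affine_preimage _
  exact AnalyticOnNhd.volume_zero_set_of_isPreconnected (hV.preimage (by fun_prop))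
    hconv.isPreconnected (hf.comp hlan fun _ ht => ht) (a := 0) (by simpa [hl] using hc)
    (by simpa [hl] using hfc)

/-- On a preconnected open set, the zero set of a nonzero real-analytic function is null. -/
theorem AnalyticOnNhd.measure_zero_set_of_isPreconnected {U : Set E} (hU : IsOpen U)
    (hUconn : IsPreconnected U) {f : E → ℝ} (hf : AnalyticOnNhd ℝ f U)
    (hne : ∃ x ∈ U, f x ≠ 0) : μ {x ∈ U | f x = 0} = 0 := by
  have : ProperSpace E := FiniteDimensional.proper_real E
  obtain ⟨a, haU, hfa⟩ := hne
  refine measure_null_of_locally_null _ fun x hx => ?_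
  obtain ⟨r, hr, hrU⟩ := Metric.isOpen_iff.1 hU x hx.1
  have hfreq : ∃ᶠ y in 𝓝 x, f y ≠ 0 := fun h =>
    hfa (hf.eqOn_zero_of_preconnected_of_eventuallyEq_zero hUconn hx.1
      (h.mono fun _ hy => not_not.1 hy) haU)
  obtain ⟨c, hfc, hc⟩ := (hfreq.and_eventually (Metric.ball_mem_nhds x hr)).exists
  refine ⟨_, inter_mem_nhdsWithin _ (Metric.ball_mem_nhds x hr), ?_⟩
  exact measure_mono_null (t := {y ∈ Metric.ball x r | f y = 0}) (fun y hy => ⟨hy.2, hy.1.2⟩)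
    ((hf.mono hrU).measure_zero_set_of_convex μ Metric.isOpen_ball (convex_ball x r) hc hfc)

end

/-- Let `U ⊆ ℝⁿ` be a connected open set and `f : U → ℝ` be real-analytic on `U`
and not identically zero. Then the zero set `{x ∈ U : f(x) = 0}` has Lebesgue
measure zero. -/
theorem analyticOnNhd_zero_set_measure_zero
    {n : ℕ} {U : Set (Fin n → ℝ)} (hU : IsOpen U) (hUconn : IsConnected U)
    {f : (Fin n → ℝ) → ℝ} (hf : AnalyticOnNhd ℝ f U)
    (hne : ∃ x ∈ U, f x ≠ 0) :
    MeasureTheory.volume {x ∈ U | f x = 0} = 0 := by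
  exact hf.measure_zero_set_of_isPreconnected MeasureTheory.volume hU hUconn.isPreconnected hne
end

section
/- Let X = (P,Q) be a C¹ vector field on ℝ², let F : ℝ² → ℝ be of class C², and let γ : ℝ → ℝ² be a T-periodic solution of X (with T > 0) such that F(γ(t)) = 0 and ∇F(γ(t)) ≠ (0,0) for all t ∈ ℝ, and such that ∫₀^T div X(γ(t)) dt = 0. Then for every λ > 0 one has ∫₀^T div(X + λF∇F)(γ(t)) dt > 0. -/
theorem hasDerivAt_fst_of_differentiable {f : ℝ → ℝ → ℝ}
    (hf : Differentiable ℝ (Function.uncurry f)) (x y : ℝ) :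
    HasDerivAt (fun x' => f x' y) (fderiv ℝ (Function.uncurry f) (x, y) (1, 0)) x :=
  HasFDerivAt.comp_hasDerivAt (l := Function.uncurry f) x (hf (x, y)).hasFDerivAt
    ((hasDerivAt_id' x).prodMk (hasDerivAt_const x y))

theorem hasDerivAt_snd_of_differentiable {f : ℝ → ℝ → ℝ}
    (hf : Differentiable ℝ (Function.uncurry f)) (x y : ℝ) :
    HasDerivAt (fun y' => f x y') (fderiv ℝ (Function.uncurry f) (x, y) (0, 1)) y :=
  HasFDerivAt.comp_hasDerivAt (l := Function.uncurry f) y (hf (x, y)).hasFDerivAt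
    ((hasDerivAt_const y x).prodMk (hasDerivAt_id' y))

theorem contDiff_uncurry_pd1 {f : ℝ → ℝ → ℝ} {m n : WithTop ℕ∞}
    (hf : ContDiff ℝ n (Function.uncurry f)) (hmn : m + 1 ≤ n) :
    ContDiff ℝ m (Function.uncurry (pd1 f)) := by
  have hd : Differentiable ℝ (Function.uncurry f) :=
    (hf.of_le (le_add_self.trans hmn)).differentiable one_ne_zero
  have h : Function.uncurry (pd1 f) = fun p => fderiv ℝ (Function.uncurry f) p (1, 0) :=
    funext fun p => (hasDerivAt_fst_of_differentiable hd p.1 p.2).deriv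
  rw [h]
  exact (hf.fderiv_right hmn).clm_apply contDiff_const

theorem contDiff_uncurry_pd2 {f : ℝ → ℝ → ℝ} {m n : WithTop ℕ∞}
    (hf : ContDiff ℝ n (Function.uncurry f)) (hmn : m + 1 ≤ n) :
    ContDiff ℝ m (Function.uncurry (pd2 f)) := by
  have hd : Differentiable ℝ (Function.uncurry f) :=
    (hf.of_le (le_add_self.trans hmn)).differentiable one_ne_zero
  have h : Function.uncurry (pd2 f) = fun p => fderiv ℝ (Function.uncurry f) p (0, 1) :=
    funext fun p => (hasDerivAt_snd_of_differentiable hd p.1 p.2).deriv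
  rw [h]
  exact (hf.fderiv_right hmn).clm_apply contDiff_const

theorem hasDerivAt_pd1 {f : ℝ → ℝ → ℝ}
    (hf : Differentiable ℝ (Function.uncurry f)) (x y : ℝ) :
    HasDerivAt (fun x' => f x' y) (pd1 f x y) x :=
  (hasDerivAt_fst_of_differentiable hf x y).differentiableAt.hasDerivAt

theorem hasDerivAt_pd2 {f : ℝ → ℝ → ℝ}
    (hf : Differentiable ℝ (Function.uncurry f)) (x y : ℝ) :
    HasDerivAt (fun y' => f x y') (pd2 f x y) y :=
  (hasDerivAt_snd_of_differentiable hf x y).differentiableAt.hasDerivAt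

/-- On the zero set of `F`, the divergence of `X + λF∇F` is `div X + λ|∇F|²`. -/
theorem div_perturbed_of_eq_zero {P Q F : ℝ → ℝ → ℝ}
    (hP : Differentiable ℝ (Function.uncurry P))
    (hQ : Differentiable ℝ (Function.uncurry Q))
    (hF : ContDiff ℝ 2 (Function.uncurry F)) (lam : ℝ) {x y : ℝ} (hxy : F x y = 0) :
    pd1 (fun x y => P x y + lam * F x y * pd1 F x y) x y
        + pd2 (fun x y => Q x y + lam * F x y * pd2 F x y) x y
      = (pd1 P x y + pd2 Q x y) + lam * (pd1 F x y ^ 2 + pd2 F x y ^ 2) := by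
  have hFd : Differentiable ℝ (Function.uncurry F) := hF.differentiable two_ne_zero
  have hF1 : Differentiable ℝ (Function.uncurry (pd1 F)) :=
    (contDiff_uncurry_pd1 (m := 1) hF one_add_one_eq_two.le).differentiable one_ne_zero
  have hF2 : Differentiable ℝ (Function.uncurry (pd2 F)) :=
    (contDiff_uncurry_pd2 (m := 1) hF one_add_one_eq_two.le).differentiable one_ne_zero
  have h1 : pd1 (fun x y => P x y + lam * F x y * pd1 F x y) x y = _ :=
    ((hasDerivAt_pd1 hP x y).add
      (((hasDerivAt_pd1 hFd x y).const_mul lam).mul (hasDerivAt_pd1 hF1 x y))).deriv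
  have h2 : pd2 (fun x y => Q x y + lam * F x y * pd2 F x y) x y = _ :=
    ((hasDerivAt_pd2 hQ x y).add
      (((hasDerivAt_pd2 hFd x y).const_mul lam).mul (hasDerivAt_pd2 hF2 x y))).deriv
  rw [h1, h2, hxy]
  ring

/-- Let `X = (P,Q)` be a `C¹` vector field on `ℝ²`, `F : ℝ² → ℝ` of class `C²`,
and `γ` a `T`-periodic solution of `X` (`T > 0`) with `F(γ(t)) = 0` and
`∇F(γ(t)) ≠ (0,0)` for all `t`, and with `∫₀ᵀ div X (γ(t)) dt = 0`. Then for
every `λ > 0` we have `∫₀ᵀ div(X + λF∇F)(γ(t)) dt > 0`. -/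
theorem integral_div_perturbed_pos
    (P Q F : ℝ → ℝ → ℝ)
    (hP : ContDiff ℝ 1 (Function.uncurry P))
    (hQ : ContDiff ℝ 1 (Function.uncurry Q))
    (hF : ContDiff ℝ 2 (Function.uncurry F))
    (T : ℝ) (hT : 0 < T) (γ : ℝ → ℝ × ℝ)
    (hper : ∀ t, γ (t + T) = γ t)
    (hsol : ∀ t, HasDerivAt γ (P (γ t).1 (γ t).2, Q (γ t).1 (γ t).2) t)
    (hFγ : ∀ t, F (γ t).1 (γ t).2 = 0)
    (hgrad : ∀ t, (pd1 F (γ t).1 (γ t).2, pd2 F (γ t).1 (γ t).2) ≠ (0, 0))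
    (hdiv : (∫ t in (0:ℝ)..T, (pd1 P (γ t).1 (γ t).2 + pd2 Q (γ t).1 (γ t).2)) = 0) :
    ∀ lam : ℝ, 0 < lam →
      0 < ∫ t in (0:ℝ)..T,
          (pd1 (fun x y => P x y + lam * F x y * pd1 F x y) (γ t).1 (γ t).2
            + pd2 (fun x y => Q x y + lam * F x y * pd2 F x y) (γ t).1 (γ t).2) := by
  intro lam hlam
  have hγ : Continuous γ := continuous_iff_continuousAt.2 fun t => (hsol t).continuousAt
  have hP1 : Continuous fun t => pd1 P (γ t).1 (γ t).2 :=
    (contDiff_uncurry_pd1 (m := 0) hP (zero_add 1).le).continuous.comp hγ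
  have hQ2 : Continuous fun t => pd2 Q (γ t).1 (γ t).2 :=
    (contDiff_uncurry_pd2 (m := 0) hQ (zero_add 1).le).continuous.comp hγ
  have hF1 : Continuous fun t => pd1 F (γ t).1 (γ t).2 :=
    (contDiff_uncurry_pd1 (m := 1) hF one_add_one_eq_two.le).continuous.comp hγ
  have hF2 : Continuous fun t => pd2 F (γ t).1 (γ t).2 :=
    (contDiff_uncurry_pd2 (m := 1) hF one_add_one_eq_two.le).continuous.comp hγ
  have hdivX : Continuous fun t => pd1 P (γ t).1 (γ t).2 + pd2 Q (γ t).1 (γ t).2 := hP1.add hQ2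
  have hG : Continuous fun t =>
      lam * (pd1 F (γ t).1 (γ t).2 ^ 2 + pd2 F (γ t).1 (γ t).2 ^ 2) :=
    continuous_const.mul ((hF1.pow 2).add (hF2.pow 2))
  simp_rw [fun t => div_perturbed_of_eq_zero (hP.differentiable one_ne_zero)
    (hQ.differentiable one_ne_zero) hF lam (hFγ t)]
  rw [intervalIntegral.integral_add (hdivX.intervalIntegrable 0 T)
    (hG.intervalIntegrable 0 T), hdiv, zero_add]
  refine intervalIntegral.intervalIntegral_pos_of_pos (hG.intervalIntegrable 0 T)
    (fun t => mul_pos hlam ?_) hT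
  have h := hgrad t
  rw [Ne, Prod.mk.injEq, not_and_or] at h
  rcases h with h | h <;> positivity
end
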